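/- Let k ∈ ℕ and let 0 < a ≤ b be real constants. There is a constant C = C(k, a, b) > 0 such that for every integer n ≥ 3 with k ≤ n − 2, every choice of integers n > d_1 > ⋯ > d_k > 0, every f ∈ SEQOPT_k(d_1,…,d_k), and all p, q ∈ (0,1) with a/(n·ln n) ≤ p ≤ b/(n·ln n) and a/(n·ln n) ≤ q ≤ b/(n·ln n), the MMAHH with acceptance operators OI and OW on f, started from x_0 uniformly distributed on {0,1}^n and s_0 = OI, has runtime T satisfying E[T] ≤ C·(n^{k+1}/(d_1·d_2⋯d_k))·ln n. -/

import Mathlib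

open MeasureTheory
open scoped ENNReal NNReal

namespace MMAHHStmt

/-- The two acceptance operators. -/
inductive Op : Type
  | OI : Op
  | OW : Op
  deriving DecidableEq

instance : MeasurableSpace Op := ⊤

/-- Search points: bit-strings of length `n`. -/
abbrev Point (n : ℕ) := Fin n → Bool

/-- The number of one-bits of a bit-string. -/
def ones {n : ℕ} (x : Point n) : ℕ := (Finset.univ.filter fun i => x i = true).card

/-- The all-ones string, the global optimum of all benchmarks considered. -/
def optimum (n : ℕ) : Point n := fun _ => true

/-- Flipping the bit in position `v`. -/
def flipBit {n : ℕ} (x : Point n) (v : Fin n) : Point n := Function.update x v (!(x v))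

open Classical in
/-- The search point obtained from `x` by proposing to flip bit `v` and applying the
acceptance operator `op` for the objective function `f`. -/
noncomputable def movedPoint {n : ℕ} (f : Point n → ℝ) (op : Op) (x : Point n) (v : Fin n) :
    Point n :=
  match op with
  | Op.OI => if f x < f (flipBit x v) then flipBit x v else x
  | Op.OW => if f (flipBit x v) < f x then flipBit x v else x

open Classical in
/-- One-step transition probability of the search point under acceptance operator `op`:
a uniformly random bit is flipped and the move is accepted or rejected according to `op`. -/
noncomputable def moveProb {n : ℕ} (f : Point n → ℝ) (op : Op) (x x' : Point n) : ℝ≥0∞ :=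
  ((Finset.univ.filter fun v => movedPoint f op x v = x').card : ℝ≥0∞) / n

/-- Transition probabilities of the two-state Markov chain on the acceptance operators. -/
noncomputable def switchProb (p q : ℝ) : Op → Op → ℝ≥0∞
  | Op.OI, Op.OI => ENNReal.ofReal (1 - p)
  | Op.OI, Op.OW => ENNReal.ofReal p
  | Op.OW, Op.OI => ENNReal.ofReal q
  | Op.OW, Op.OW => ENNReal.ofReal (1 - q)

/-- One-step transition probabilities of the MMAHH on the state space
`Point n × Op`: the search point moves according to the current acceptance operator, and,
independently, the operator switches according to the two-state Markov chain. -/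
noncomputable def mmahhTrans {n : ℕ} (f : Point n → ℝ) (p q : ℝ) :
    Point n × Op → Point n × Op → ℝ≥0∞ :=
  fun s s' => moveProb f s.2 s.1 s'.1 * switchProb p q s.2 s'.2

/-- `X` is (a version of) the MMAHH Markov chain with objective function `f` and switching
probabilities `p` and `q`, under the measure `μ`: each `X t` is measurable, and conditionally
on any history, the next state is distributed according to `mmahhTrans`. -/
def IsMMAHH {n : ℕ} {Ω : Type*} [MeasurableSpace Ω] (μ : Measure Ω)
    (X : ℕ → Ω → Point n × Op) (f : Point n → ℝ) (p q : ℝ) : Prop :=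
  (∀ t, Measurable (X t)) ∧
  ∀ (t : ℕ) (σ : ℕ → Point n × Op) (s' : Point n × Op),
    μ {ω | (∀ i ≤ t, X i ω = σ i) ∧ X (t + 1) ω = s'}
      = μ {ω | ∀ i ≤ t, X i ω = σ i} * mmahhTrans f p q (σ t) s'

/-- The runtime: the first hitting time of the global optimum, as an extended natural number
(`⊤` if the optimum is never reached). -/
noncomputable def hitTime {n : ℕ} {Ω : Type*} (X : ℕ → Ω → Point n × Op) (ω : Ω) : ℕ∞ :=
  ⨅ t ∈ {t : ℕ | (X t ω).1 = optimum n}, (t : ℕ∞)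

/-- The `k`-th switching time between the two acceptance operators (with junk value given by
`Nat.sInf ∅ = 0` on the probability-zero event that no further switch occurs). -/
noncomputable def switchTime {n : ℕ} {Ω : Type*} (X : ℕ → Ω → Point n × Op) : ℕ → Ω → ℕ
  | 0, _ => 0
  | k + 1, ω =>
      sInf {t : ℕ | switchTime X k ω ≤ t ∧ (X t ω).2 ≠ (X (switchTime X k ω) ω).2}

/-- `f : {0,1}^n → ℝ` belongs to the class `SEQOPT_k(d 1, …, d k)`, where `d 0 = n` and
`d (k+1) = 0`: the all-ones string is the unique global maximum, and between consecutive
layers the function is alternatingly increasing and decreasing, with sign changes exactly at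
the layers `d 1 > ⋯ > d k`. -/
def SeqOpt (n k : ℕ) (d : ℕ → ℕ) (f : Point n → ℝ) : Prop :=
  d 0 = n ∧ d (k + 1) = 0 ∧ (∀ i, i ≤ k → d (i + 1) < d i) ∧
  (∀ x : Point n, x ≠ optimum n → f x < f (optimum n)) ∧
  (∀ l, l ≤ k → ∀ h : ℕ, d (l + 1) ≤ h → h < d l →
    ((k - l) % 2 = 0 →
      ∀ x y : Point n, n - ones x = h → n - ones y = h + 1 → f x > f y) ∧
    ((k - l) % 2 = 1 →
      ∀ x y : Point n, n - ones x = h → n - ones y = h + 1 → f x < f y))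

/-! ### Additive drift theorem for the chain -/

instance : Fintype Op := ⟨{Op.OI, Op.OW}, fun x => by cases x <;> simp⟩

instance : DiscreteMeasurableSpace Op := ⟨fun _ => trivial⟩

instance : MeasurableSingletonClass Op := ⟨fun _ => trivial⟩

/-- The event that the optimum was not visited up to time `t`. -/
def notHit {n : ℕ} {Ω : Type*} (X : ℕ → Ω → Point n × Op) (t : ℕ) : Set Ω :=
  {ω | ∀ i ≤ t, (X i ω).1 ≠ optimum n}

/-- The history up to time `t`. -/
def hist {n : ℕ} {Ω : Type*} (X : ℕ → Ω → Point n × Op) (t : ℕ) (ω : Ω) :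
    Fin (t + 1) → Point n × Op := fun i => X i ω

lemma measurable_hist {n : ℕ} {Ω : Type*} [MeasurableSpace Ω] (X : ℕ → Ω → Point n × Op)
    (hX : ∀ t, Measurable (X t)) (t : ℕ) : Measurable (hist X t) :=
  measurable_pi_lambda _ fun i => hX i

lemma measurableSet_notHit {n : ℕ} {Ω : Type*} [MeasurableSpace Ω] (X : ℕ → Ω → Point n × Op)
    (hX : ∀ t, Measurable (X t)) (t : ℕ) : MeasurableSet (notHit X t) := by
  have : notHit X t = ⋂ i ∈ Finset.range (t+1), X i ⁻¹' {s | s.1 ≠ optimum n} := by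
    ext ω
    simp [notHit]
  rw [this]
  exact Finset.measurableSet_biInter _ fun i _ => hX i (Set.toFinite _).measurableSet

lemma hitTime_le {n : ℕ} {Ω : Type*} (X : ℕ → Ω → Point n × Op) (ω : Ω) :
    (hitTime X ω : ℝ≥0∞) ≤ ∑' t, (notHit X t).indicator (fun _ => (1 : ℝ≥0∞)) ω := by
  classical
  by_cases h : ∃ t, (X t ω).1 = optimum n
  · have h1 : hitTime X ω ≤ (Nat.find h : ℕ∞) := by
      unfold hitTime
      exact iInf₂_le (Nat.find h) (Nat.find_spec h)
    have h2 : (hitTime X ω : ℝ≥0∞) ≤ ((Nat.find h : ℕ) : ℝ≥0∞) := by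
      have := ENat.toENNReal_le.2 h1
      simpa using this
    refine h2.trans ?_
    calc ((Nat.find h : ℕ) : ℝ≥0∞)
        = ∑ t ∈ Finset.range (Nat.find h), (notHit X t).indicator (fun _ => (1 : ℝ≥0∞)) ω := by
          rw [Finset.sum_congr rfl (g := fun _ => (1 : ℝ≥0∞))]
          · simp
          · intro t ht
            rw [Set.indicator_of_mem]
            intro i hi
            exact Nat.find_min h (lt_of_le_of_lt hi (Finset.mem_range.1 ht))
      _ ≤ _ := ENNReal.sum_le_tsum _
  · push Not at h
    have : ∀ t, (notHit X t).indicator (fun _ => (1 : ℝ≥0∞)) ω = 1 := by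
      intro t
      rw [Set.indicator_of_mem]
      intro i _
      exact h i
    simp only [this]
    rw [ENNReal.tsum_const_eq_top_of_ne_zero one_ne_zero]
    exact le_top

/-- One step of the drift argument. -/
lemma drift_step {n : ℕ} {Ω : Type*} [MeasurableSpace Ω] (μ : Measure Ω)
    (X : ℕ → Ω → Point n × Op) (f : Point n → ℝ) (p q : ℝ) (hX : IsMMAHH μ X f p q)
    (V : Point n × Op → ℝ≥0∞)
    (hV : ∀ s : Point n × Op, s.1 ≠ optimum n →
      ∑ s', mmahhTrans f p q s s' * V s' + 1 ≤ V s) (t : ℕ) :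
    ∫⁻ ω, (notHit X t).indicator (fun ω => V (X (t+1) ω)) ω ∂μ + μ (notHit X t)
      ≤ ∫⁻ ω, (notHit X t).indicator (fun ω => V (X t ω)) ω ∂μ := by
  classical
  set good : (Fin (t+1) → Point n × Op) → ℝ≥0∞ :=
    fun σ => if ∀ i, (σ i).1 ≠ optimum n then 1 else 0 with hgood
  have hmem : ∀ ω, ω ∈ notHit X t ↔ ∀ i, (hist X t ω i).1 ≠ optimum n := by
    intro ω
    constructor
    · intro h i
      exact h i (Nat.lt_succ_iff.1 i.2)
    · intro h i hi
      exact h ⟨i, Nat.lt_succ_iff.2 hi⟩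
  have e1 : ∀ (F : Ω → ℝ≥0∞) ω, (notHit X t).indicator F ω = good (hist X t ω) * F ω := by
    intro F ω
    by_cases h : ω ∈ notHit X t
    · rw [Set.indicator_of_mem h]
      simp only [hgood]
      rw [if_pos ((hmem ω).1 h), one_mul]
    · rw [Set.indicator_of_notMem h]
      simp only [hgood]
      rw [if_neg (fun h' => h ((hmem ω).2 h')), zero_mul]
  have hm := measurable_hist X hX.1 t
  have key : ∀ (g : (Fin (t+1) → Point n × Op) → ℝ≥0∞),
      ∫⁻ ω, g (hist X t ω) ∂μ = ∑ σ, g σ * μ (hist X t ⁻¹' {σ}) := by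
    intro g
    rw [← lintegral_map (f := g) (measurable_of_finite g) hm, lintegral_fintype]
    refine Finset.sum_congr rfl fun σ _ => ?_
    rw [Measure.map_apply hm (measurableSet_singleton σ)]
  have key2 : ∀ (g : (Fin (t+1) → Point n × Op) × (Point n × Op) → ℝ≥0∞),
      ∫⁻ ω, g (hist X t ω, X (t+1) ω) ∂μ
        = ∑ σ, ∑ s', g (σ, s') * (μ (hist X t ⁻¹' {σ}) * mmahhTrans f p q (σ (Fin.last t)) s') := by
    intro g
    have hm2 : Measurable (fun ω => (hist X t ω, X (t+1) ω)) := hm.prodMk (hX.1 _)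
    rw [← lintegral_map (f := g) (measurable_of_finite g) hm2, lintegral_fintype,
      Fintype.sum_prod_type]
    refine Finset.sum_congr rfl fun σ _ => Finset.sum_congr rfl fun s' _ => ?_
    rw [Measure.map_apply hm2 (measurableSet_singleton _)]
    congr 1
    obtain ⟨τ, hτ⟩ : ∃ τ : ℕ → Point n × Op, ∀ i : Fin (t+1), τ i = σ i :=
      ⟨fun i => if h : i < t + 1 then σ ⟨i, h⟩ else σ 0, fun i => by
        simp only [i.2, dif_pos]⟩
    have h0 := hX.2 t τ s'
    have hs : {ω | ∀ i ≤ t, X i ω = τ i} = hist X t ⁻¹' {σ} := by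
      ext ω
      simp only [Set.mem_ofPred_eq, Set.mem_preimage, Set.mem_singleton_iff, funext_iff]
      constructor
      · intro h i
        rw [← hτ i]
        exact h i (Nat.lt_succ_iff.1 i.2)
      · intro h i hi
        exact (h ⟨i, Nat.lt_succ_iff.2 hi⟩).trans (hτ ⟨i, Nat.lt_succ_iff.2 hi⟩).symm
    have hl : τ t = σ (Fin.last t) := hτ (Fin.last t)
    rw [hs, hl] at h0
    rw [← h0]
    congr 1
    ext ω
    have := Set.ext_iff.1 hs ω
    simp only [Set.mem_ofPred_eq] at this
    simp only [Set.mem_preimage, Set.mem_singleton_iff, Prod.mk.injEq, Set.mem_ofPred_eq, this]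
  have hA : μ (notHit X t) = ∑ σ, good σ * μ (hist X t ⁻¹' {σ}) := by
    rw [← key, ← lintegral_indicator_one (measurableSet_notHit X hX.1 t)]
    refine lintegral_congr fun ω => ?_
    rw [e1]; simp
  have hB : ∫⁻ ω, (notHit X t).indicator (fun ω => V (X t ω)) ω ∂μ
      = ∑ σ, (good σ * V (σ (Fin.last t))) * μ (hist X t ⁻¹' {σ}) := by
    rw [← key (fun σ => good σ * V (σ (Fin.last t)))]
    refine lintegral_congr fun ω => ?_
    rw [e1]; simp [hist]
  have hC : ∫⁻ ω, (notHit X t).indicator (fun ω => V (X (t+1) ω)) ω ∂μ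
      = ∑ σ, ∑ s', (good σ * V s') *
        (μ (hist X t ⁻¹' {σ}) * mmahhTrans f p q (σ (Fin.last t)) s') := by
    rw [← key2 (fun σ => good σ.1 * V σ.2)]
    refine lintegral_congr fun ω => ?_
    rw [e1]
  rw [hA, hB, hC, ← Finset.sum_add_distrib]
  refine Finset.sum_le_sum fun σ _ => ?_
  by_cases h : ∀ i, (σ i).1 ≠ optimum n
  · have hg : good σ = 1 := by simp only [hgood]; rw [if_pos h]
    simp only [hg, one_mul]
    calc ∑ s', V s' * (μ (hist X t ⁻¹' {σ}) * mmahhTrans f p q (σ (Fin.last t)) s')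
          + μ (hist X t ⁻¹' {σ})
        = (∑ s', mmahhTrans f p q (σ (Fin.last t)) s' * V s' + 1) * μ (hist X t ⁻¹' {σ}) := by
          rw [add_mul, one_mul, Finset.sum_mul]
          congr 1
          refine Finset.sum_congr rfl fun s' _ => ?_
          ring
      _ ≤ _ := by gcongr; exact hV _ (h _)
  · have hg : good σ = 0 := by simp only [hgood]; rw [if_neg h]
    simp [hg]

lemma drift_bound {n : ℕ} {Ω : Type*} [MeasurableSpace Ω] (μ : Measure Ω)
    [IsProbabilityMeasure μ]
    (X : ℕ → Ω → Point n × Op) (f : Point n → ℝ) (p q : ℝ) (hX : IsMMAHH μ X f p q)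
    (V : Point n × Op → ℝ≥0∞) (M : ℝ≥0∞) (hM : ∀ s, V s ≤ M)
    (hV : ∀ s : Point n × Op, s.1 ≠ optimum n →
      ∑ s', mmahhTrans f p q s s' * V s' + 1 ≤ V s) :
    ∫⁻ ω, (hitTime X ω : ℝ≥0∞) ∂μ ≤ M := by
  have h1 : ∀ m, ∑ t ∈ Finset.range (m+1), μ (notHit X t)
      + ∫⁻ ω, (notHit X m).indicator (fun ω => V (X (m+1) ω)) ω ∂μ ≤ M := by
    intro m
    induction m with
    | zero =>
      have := drift_step μ X f p q hX V hV 0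
      rw [zero_add, Finset.sum_range_one, add_comm]
      refine this.trans ?_
      calc _ ≤ ∫⁻ _, M ∂μ := by
            refine lintegral_mono fun ω => ?_
            exact (Set.indicator_le_self _ _ _).trans (hM _)
        _ = M := by simp
    | succ m ih =>
      have := drift_step μ X f p q hX V hV (m+1)
      rw [Finset.sum_range_succ, add_assoc]
      refine le_trans ?_ ih
      gcongr
      rw [add_comm]
      refine this.trans ?_
      refine lintegral_mono fun ω => ?_
      refine Set.indicator_le_indicator_of_subset ?_ (fun _ => zero_le) ω
      intro ω h i hi
      exact h i (hi.trans (Nat.le_succ m))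
  calc ∫⁻ ω, (hitTime X ω : ℝ≥0∞) ∂μ
      ≤ ∫⁻ ω, ∑' t, (notHit X t).indicator (fun _ => (1 : ℝ≥0∞)) ω ∂μ :=
        lintegral_mono fun ω => hitTime_le X ω
    _ = ∑' t, μ (notHit X t) := by
        rw [lintegral_tsum]
        · refine tsum_congr fun t => ?_
          exact lintegral_indicator_one (measurableSet_notHit X hX.1 t)
        · intro t
          exact (measurable_const.indicator (measurableSet_notHit X hX.1 t)).aemeasurable
    _ ≤ M := by
        refine ENNReal.tsum_le_of_sum_range_le fun m => ?_
        refine le_trans ?_ (h1 m)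
        rw [Finset.sum_range_succ, add_assoc]
        exact le_self_add

/-! ### From real-valued drift to the runtime bound -/

/-- The other operator. -/
def Op.other : Op → Op
  | Op.OI => Op.OW
  | Op.OW => Op.OI

/-- The probability of leaving the operator. -/
def rate (p q : ℝ) : Op → ℝ
  | Op.OI => p
  | Op.OW => q

/-- The one-step expectation of `W`. -/
noncomputable def stepE {n : ℕ} (f : Point n → ℝ) (p q : ℝ) (W : Point n → Op → ℝ)
    (x : Point n) (op : Op) : ℝ :=
  (∑ v, ((1 - rate p q op) * W (movedPoint f op x v) op
    + rate p q op * W (movedPoint f op x v) op.other)) / n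

lemma sum_moveProb {n : ℕ} (f : Point n → ℝ) (op : Op) (x : Point n) (g : Point n → ℝ≥0∞) :
    ∑ x', moveProb f op x x' * g x' = (∑ v, g (movedPoint f op x v)) / n := by
  classical
  unfold moveProb
  simp only [Finset.card_filter, Nat.cast_sum, div_eq_mul_inv, Finset.sum_mul, Nat.cast_ite,
    Nat.cast_one, Nat.cast_zero]
  rw [Finset.sum_comm]
  refine Finset.sum_congr rfl fun v _ => ?_
  rw [Finset.sum_eq_single (movedPoint f op x v)]
  · simp [mul_comm]
  · intro b _ hb
    rw [if_neg (Ne.symm hb)]; simp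
  · simp

lemma sum_switch (p q : ℝ) (op : Op) (g : Op → ℝ≥0∞) :
    ∑ op', switchProb p q op op' * g op'
      = ENNReal.ofReal (1 - rate p q op) * g op + ENNReal.ofReal (rate p q op) * g op.other := by
  have : (Finset.univ : Finset Op) = {Op.OI, Op.OW} := rfl
  rw [this, Finset.sum_pair (by simp)]
  cases op
  · rfl
  · rw [add_comm]; rfl

lemma runtime_of_drift {n : ℕ} (hn : 0 < n) {Ω : Type*} [MeasurableSpace Ω] (μ : Measure Ω)
    [IsProbabilityMeasure μ]
    (X : ℕ → Ω → Point n × Op) (f : Point n → ℝ) (p q : ℝ) (hp : 0 < p) (hp1 : p < 1)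
    (hq : 0 < q) (hq1 : q < 1) (hX : IsMMAHH μ X f p q)
    (W : Point n → Op → ℝ) (h0 : ∀ x op, 0 ≤ W x op) (h1 : ∀ x op, W x op ≤ 1)
    (δ : ℝ) (hδ : 0 < δ)
    (hW : ∀ x op, x ≠ optimum n → W x op + δ ≤ stepE f p q W x op) :
    ∫⁻ ω, (hitTime X ω : ℝ≥0∞) ∂μ ≤ ENNReal.ofReal (1 / δ) := by
  have hV0 : ∀ x op, 0 ≤ (1 - W x op) / δ := fun x op =>
    div_nonneg (sub_nonneg.2 (h1 x op)) hδ.le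
  have hr0 : ∀ op, 0 ≤ rate p q op := by intro op; cases op; exacts [hp.le, hq.le]
  have hr1 : ∀ op, 0 ≤ 1 - rate p q op := by
    intro op; cases op; exacts [sub_nonneg.2 hp1.le, sub_nonneg.2 hq1.le]
  have hn' : (0 : ℝ) < n := by exact_mod_cast hn
  refine drift_bound μ X f p q hX (fun s => ENNReal.ofReal ((1 - W s.1 s.2) / δ)) _ ?_ ?_
  · intro s
    apply ENNReal.ofReal_le_ofReal
    have := h0 s.1 s.2
    gcongr
    linarith
  · rintro ⟨x, op⟩ hx
    have e : ∑ s', mmahhTrans f p q (x, op) s' * ENNReal.ofReal ((1 - W s'.1 s'.2) / δ)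
        = ENNReal.ofReal ((1 - stepE f p q W x op) / δ) := by
      rw [Fintype.sum_prod_type]
      simp only [mmahhTrans, mul_assoc]
      simp only [← Finset.mul_sum]
      rw [sum_moveProb]
      simp only [sum_switch]
      have : ∀ v, ENNReal.ofReal (1 - rate p q op)
            * ENNReal.ofReal ((1 - W (movedPoint f op x v) op) / δ)
          + ENNReal.ofReal (rate p q op)
            * ENNReal.ofReal ((1 - W (movedPoint f op x v) op.other) / δ)
          = ENNReal.ofReal ((1 - ((1 - rate p q op) * W (movedPoint f op x v) op
    + rate p q op * W (movedPoint f op x v) op.other)) / δ) := by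
        intro v
        rw [← ENNReal.ofReal_mul (hr1 _), ← ENNReal.ofReal_mul (hr0 _), ← ENNReal.ofReal_add
          (mul_nonneg (hr1 _) (hV0 _ _)) (mul_nonneg (hr0 _) (hV0 _ _))]
        congr 1
        field_simp
        ring
      simp only [this]
      rw [← ENNReal.ofReal_sum_of_nonneg, ← ENNReal.ofReal_natCast,
        ← ENNReal.ofReal_div_of_pos hn']
      · congr 1
        unfold stepE
        rw [← Finset.sum_div, Finset.sum_sub_distrib]
        simp
        field_simp
      · intro v _
        apply div_nonneg _ hδ.le
        have a1 := mul_le_mul_of_nonneg_left (h1 (movedPoint f op x v) op) (hr1 op)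
        have a2 := mul_le_mul_of_nonneg_left (h1 (movedPoint f op x v) op.other) (hr0 op)
        linarith
    simp only [e]
    have hpos : 0 ≤ (1 - stepE f p q W x op) / δ ∨ (1 - stepE f p q W x op) / δ < 0 := le_or_gt _ _
    have hle := hW x op hx
    have hS : stepE f p q W x op ≤ 1 := by
      unfold stepE
      rw [div_le_one hn']
      calc _ ≤ ∑ v : Fin n, (1 : ℝ) := by
            refine Finset.sum_le_sum fun v _ => ?_
            have a1 := mul_le_mul_of_nonneg_left (h1 (movedPoint f op x v) op) (hr1 op)
            have a2 := mul_le_mul_of_nonneg_left (h1 (movedPoint f op x v) op.other) (hr0 op)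
            linarith
        _ = n := by simp
    rw [← ENNReal.ofReal_one, ← ENNReal.ofReal_add (div_nonneg (sub_nonneg.2 hS) hδ.le) zero_le_one]
    apply ENNReal.ofReal_le_ofReal
    rw [div_add_one hδ.ne']
    gcongr
    linarith

/-! ### Layers -/

/-- The number of zero-bits. -/
def zs {n : ℕ} (x : Point n) : ℕ := n - ones x

lemma ones_add {n : ℕ} (x : Point n) :
    ones x + (Finset.univ.filter fun i => x i = false).card = n := by
  have := Finset.card_filter_add_card_filter_not (s := (Finset.univ : Finset (Fin n)))
    (fun i => x i = true)
  simpa [ones] using this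

lemma zs_eq {n : ℕ} (x : Point n) : zs x = (Finset.univ.filter fun i => x i = false).card := by
  have := ones_add x
  unfold zs; omega

lemma ones_le {n : ℕ} (x : Point n) : ones x ≤ n := by
  have := ones_add x
  omega

lemma zs_le {n : ℕ} (x : Point n) : zs x ≤ n := Nat.sub_le _ _

lemma zs_pos {n : ℕ} (x : Point n) (hx : x ≠ optimum n) : 0 < zs x := by
  rw [zs_eq, Finset.card_pos]
  by_contra h
  apply hx
  funext i
  rw [Finset.not_nonempty_iff_eq_empty, Finset.filter_eq_empty_iff] at h
  have := h (Finset.mem_univ i)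
  simpa [optimum] using this

lemma zs_flip_false {n : ℕ} (x : Point n) (v : Fin n) (hv : x v = false) :
    zs (flipBit x v) + 1 = zs x := by
  rw [zs_eq, zs_eq]
  have : (Finset.univ.filter fun i => x i = false)
      = insert v (Finset.univ.filter fun i => flipBit x v i = false) := by
    ext i
    by_cases h : i = v
    · subst h; simp [hv]
    · simp [flipBit, Function.update, h]
  rw [this, Finset.card_insert_of_notMem]
  simp [flipBit, hv]

lemma zs_flip_true {n : ℕ} (x : Point n) (v : Fin n) (hv : x v = true) :
    zs (flipBit x v) = zs x + 1 := by
  have h := zs_flip_false (flipBit x v) v (by simp [flipBit, hv])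
  have : flipBit (flipBit x v) v = x := by
    funext i
    by_cases h : i = v
    · subst h; simp [flipBit]
    · simp [flipBit, Function.update, h]
  rw [this] at h
  exact h.symm

lemma stepE_ge {n : ℕ} (hn : 0 < n) (f : Point n → ℝ) (p q : ℝ) (W : Point n → Op → ℝ)
    (x : Point n) (op : Op) (c0 c1 : ℝ)
    (h0 : ∀ v, x v = false → c0 ≤ (1 - rate p q op) * W (movedPoint f op x v) op
      + rate p q op * W (movedPoint f op x v) op.other)
    (h1 : ∀ v, x v = true → c1 ≤ (1 - rate p q op) * W (movedPoint f op x v) op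
      + rate p q op * W (movedPoint f op x v) op.other) :
    c1 + (zs x : ℝ) / n * (c0 - c1) ≤ stepE f p q W x op := by
  have hn' : (0 : ℝ) < n := by exact_mod_cast hn
  have : ∑ v, (if x v = false then c0 else c1) = zs x * c0 + ones x * c1 := by
    rw [Finset.sum_ite, zs_eq]
    simp [ones]
  have h2 : (ones x : ℝ) = n - zs x := by
    have := ones_add x
    rw [← zs_eq] at this
    have h : ((ones x : ℝ) + zs x) = n := by exact_mod_cast this
    linarith
  have e : c1 + (zs x : ℝ) / n * (c0 - c1) = (∑ v, (if x v = false then c0 else c1)) / n := by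
    rw [this, h2]
    field_simp
    ring
  rw [e]
  unfold stepE
  gcongr with v
  by_cases hv : x v = false
  · rw [if_pos hv]; exact h0 v hv
  · rw [if_neg hv]; exact h1 v (by simpa using hv)

/-- The operator that moves downward in region `l`. -/
def gop (k l : ℕ) : Op := if (k - l) % 2 = 0 then Op.OI else Op.OW

lemma other_other (op : Op) : op.other.other = op := by cases op <;> rfl

lemma other_ne (op : Op) : op.other ≠ op := by cases op <;> simp [Op.other]

lemma eq_or_other (op op' : Op) : op = op' ∨ op = op'.other := by
  cases op <;> cases op' <;> simp [Op.other]

lemma gop_succ (k l : ℕ) (h : l + 1 ≤ k) : gop k (l+1) = (gop k l).other := by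
  unfold gop
  rcases Nat.mod_two_eq_zero_or_one (k - l) with h1 | h1
  · have h3 : ¬ (k - (l + 1)) % 2 = 0 := by omega
    rw [if_pos h1, if_neg h3]; rfl
  · have h2 : ¬ (k - l) % 2 = 0 := by omega
    have h3 : (k - (l + 1)) % 2 = 0 := by omega
    rw [if_neg h2, if_pos h3]; rfl

section
variable {n k : ℕ} {d : ℕ → ℕ} {f : Point n → ℝ}

lemma cmp_even (hS : SeqOpt n k d f) {l : ℕ} (hl : l ≤ k) (he : (k - l) % 2 = 0)
    {x y : Point n} (hxy : zs y = zs x + 1) (h1 : d (l+1) ≤ zs x) (h2 : zs x < d l) :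
    f y < f x :=
  (hS.2.2.2.2 l hl (zs x) h1 h2).1 he x y rfl hxy

lemma cmp_odd (hS : SeqOpt n k d f) {l : ℕ} (hl : l ≤ k) (he : (k - l) % 2 = 1)
    {x y : Point n} (hxy : zs y = zs x + 1) (h1 : d (l+1) ≤ zs x) (h2 : zs x < d l) :
    f x < f y :=
  (hS.2.2.2.2 l hl (zs x) h1 h2).2 he x y rfl hxy

lemma moved_down (hS : SeqOpt n k d f) {l : ℕ} (hl : l ≤ k) {x : Point n} {v : Fin n}
    (hv : x v = false) (h1 : d (l+1) < zs x) (h2 : zs x ≤ d l) :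
    movedPoint f (gop k l) x v = flipBit x v ∧ movedPoint f (gop k l).other x v = x := by
  have hz := zs_flip_false x v hv
  rcases Nat.mod_two_eq_zero_or_one (k - l) with he | he
  · have := cmp_even hS hl he hz.symm (by omega) (by omega)
    have hg : gop k l = Op.OI := if_pos he
    rw [hg]
    exact ⟨if_pos this, if_neg this.le.not_gt⟩
  · have := cmp_odd hS hl he hz.symm (by omega) (by omega)
    have hg : gop k l = Op.OW := if_neg (by omega)
    rw [hg]
    exact ⟨if_pos this, if_neg this.le.not_gt⟩

lemma moved_up (hS : SeqOpt n k d f) {l : ℕ} (hl : l ≤ k) {x : Point n} {v : Fin n}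
    (hv : x v = true) (h1 : d (l+1) ≤ zs x) (h2 : zs x < d l) :
    movedPoint f (gop k l) x v = x ∧ movedPoint f (gop k l).other x v = flipBit x v := by
  have hz := zs_flip_true x v hv
  rcases Nat.mod_two_eq_zero_or_one (k - l) with he | he
  · have := cmp_even hS hl he hz (by omega) (by omega)
    have hg : gop k l = Op.OI := if_pos he
    rw [hg]
    exact ⟨if_neg this.le.not_gt, if_pos this⟩
  · have := cmp_odd hS hl he hz (by omega) (by omega)
    have hg : gop k l = Op.OW := if_neg (by omega)
    rw [hg]
    exact ⟨if_neg this.le.not_gt, if_pos this⟩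

/-- At the upper boundary of a region, the bad operator does not move. -/
lemma moved_top (hS : SeqOpt n k d f) {l : ℕ} (hl : l ≤ k) {x : Point n} {v : Fin n}
    (hv : x v = true) (h2 : zs x = d l) :
    movedPoint f (gop k l).other x v = x := by
  have hz := zs_flip_true x v hv
  have hle := zs_le (flipBit x v)
  rcases Nat.eq_zero_or_pos l with h0 | h0
  · subst h0
    rw [hS.1] at h2
    omega
  · obtain ⟨m, rfl⟩ : ∃ m, l = m + 1 := ⟨l - 1, by omega⟩
    have hd := hS.2.2.1 m (by omega)
    have := (moved_up hS (l := m) (by omega) hv (by omega) (by omega)).1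
    rw [gop_succ k m hl, other_other]
    exact this

/-- The region of layer `y`. -/
noncomputable def reg (k : ℕ) (d : ℕ → ℕ) (y : ℕ) : ℕ :=
  Nat.findGreatest (fun i => y ≤ d i) k

lemma d_anti (hS : SeqOpt n k d f) {i j : ℕ} (hij : i ≤ j) (hj : j ≤ k + 1) : d j ≤ d i := by
  induction j, hij using Nat.le_induction with
  | base => exact le_rfl
  | succ j hij ih =>
    have := hS.2.2.1 j (by omega)
    have := ih (by omega)
    omega

lemma reg_spec (hS : SeqOpt n k d f) {y : ℕ} (hy : 0 < y) (hyn : y ≤ n) :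
    reg k d y ≤ k ∧ d (reg k d y + 1) < y ∧ y ≤ d (reg k d y) := by
  have h1 : reg k d y ≤ k := Nat.findGreatest_le k
  refine ⟨h1, ?_, ?_⟩
  · rcases Nat.lt_or_ge (reg k d y) k with h | h
    · have := Nat.findGreatest_is_greatest (P := fun i => y ≤ d i) (n := k)
        (k := reg k d y + 1) (Nat.lt_succ_self _) (by omega)
      omega
    · have : reg k d y = k := le_antisymm h1 h
      rw [this, hS.2.1]; exact hy
  · exact Nat.findGreatest_spec (P := fun i => y ≤ d i) (m := 0) (Nat.zero_le k)
      (by rw [hS.1]; exact hyn)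

lemma reg_eq (hS : SeqOpt n k d f) {y l : ℕ} (hl : l ≤ k) (h1 : d (l+1) < y) (h2 : y ≤ d l) :
    reg k d y = l := by
  have hn : y ≤ n := by
    have := d_anti hS (Nat.zero_le l) (by omega)
    rw [hS.1] at this; omega
  obtain ⟨g1, g2, g3⟩ := reg_spec hS (y := y) (by omega) hn
  rcases lt_trichotomy (reg k d y) l with h | h | h
  · have := d_anti hS (i := reg k d y + 1) (j := l) h (by omega)
    omega
  · exact h
  · have := d_anti hS (i := l + 1) (j := reg k d y) h (by omega)
    omega

/-- The general shape of our potential functions. -/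
noncomputable def pot (k : ℕ) (d : ℕ → ℕ) (G B : ℕ → ℝ) (y : ℕ) (op : Op) : ℝ :=
  if y = 0 then 1 else if op = gop k (reg k d y) then G y else B y

lemma pot_good (hS : SeqOpt n k d f) (G B : ℕ → ℝ) {y l : ℕ} (hl : l ≤ k) (h1 : d (l+1) < y)
    (h2 : y ≤ d l) : pot k d G B y (gop k l) = G y := by
  unfold pot
  rw [if_neg (by omega), reg_eq hS hl h1 h2, if_pos rfl]

lemma pot_bad (hS : SeqOpt n k d f) (G B : ℕ → ℝ) {y l : ℕ} (hl : l ≤ k) (h1 : d (l+1) < y)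
    (h2 : y ≤ d l) : pot k d G B y (gop k l).other = B y := by
  unfold pot
  rw [if_neg (by omega), reg_eq hS hl h1 h2, if_neg (other_ne _)]

lemma pot_nonneg (G B : ℕ → ℝ) (hG : ∀ y, 0 ≤ G y) (hB : ∀ y, 0 ≤ B y) (y : ℕ) (op : Op) :
    0 ≤ pot k d G B y op := by
  unfold pot
  split_ifs
  exacts [zero_le_one, hG _, hB _]

end

section
variable {n k : ℕ} {d : ℕ → ℕ} {f : Point n → ℝ}

lemma pot_le_one (G B : ℕ → ℝ) (hG : ∀ y, G y ≤ 1) (hB : ∀ y, B y ≤ 1) (y : ℕ) (op : Op) :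
    pot k d G B y op ≤ 1 := by
  unfold pot
  split_ifs
  exacts [le_rfl, hG _, hB _]

lemma rate_bounds {p q A P : ℝ} (h1 : A ≤ p) (h2 : A ≤ q) (h3 : p ≤ P) (h4 : q ≤ P) (op : Op) :
    A ≤ rate p q op ∧ rate p q op ≤ P := by
  cases op
  exacts [⟨h1, h3⟩, ⟨h2, h4⟩]

/-! ### The drift for small `n` -/

lemma drift_small (hn : 0 < n) (hS : SeqOpt n k d f) (p q A ε : ℝ) (hA : 0 < A) (hAp : A ≤ p)
    (hAq : A ≤ q) (hp1 : p ≤ 1) (hq1 : q ≤ 1) (hε : ε = A / (2 * n)) (x : Point n) (op : Op)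
    (hx : x ≠ optimum n) :
    pot k d (fun y => ε ^ (2 * y)) (fun y => ε ^ (2 * y + 1)) (zs x) op + ε ^ (2 * n + 1)
      ≤ stepE f p q
        (fun x op => pot k d (fun y => ε ^ (2 * y)) (fun y => ε ^ (2 * y + 1)) (zs x) op) x op := by
  have hn' : (1 : ℝ) ≤ n := by exact_mod_cast hn
  have hε0 : 0 < ε := by rw [hε]; positivity
  have hA1 : A ≤ 1 := hAp.trans hp1
  have hεA : 2 * n * ε = A := by rw [hε]; field_simp
  have hε1 : ε ≤ 1 := by nlinarith
  obtain ⟨r1, r2⟩ := rate_bounds hAp hAq hp1 hq1 op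
  set r := rate p q op with hr
  set G : ℕ → ℝ := fun y => ε ^ (2 * y) with hG
  set B : ℕ → ℝ := fun y => ε ^ (2 * y + 1) with hB
  have hG0 : ∀ y, 0 ≤ G y := fun y => by simp only [hG]; positivity
  have hB0 : ∀ y, 0 ≤ B y := fun y => by simp only [hB]; positivity
  have hP0 := pot_nonneg (k := k) (d := d) G B hG0 hB0
  have hy := zs_pos x hx
  have hyn := zs_le x
  obtain ⟨l1, l2, l3⟩ := reg_spec hS hy hyn
  set l := reg k d (zs x) with hl
  have hy1 : (1 : ℝ) / n ≤ (zs x : ℝ) / n := by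
    gcongr
    exact_mod_cast hy
  have hpow : ε ^ (2 * n + 1) ≤ ε ^ (2 * zs x + 1) :=
    pow_le_pow_of_le_one hε0.le hε1 (by omega)
  have hpow2 : ε ^ (2 * zs x + 1) ≤ ε ^ (2 * zs x) :=
    pow_le_pow_of_le_one hε0.le hε1 (by omega)
  have hnn : ∀ m, 0 ≤ (1 - r) * pot k d G B (zs (movedPoint f op x m)) op
      + r * pot k d G B (zs (movedPoint f op x m)) op.other := fun m =>
    add_nonneg (mul_nonneg (by linarith) (hP0 _ _)) (mul_nonneg (by linarith) (hP0 _ _))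
  rcases eq_or_other op (gop k l) with ho | ho
  · -- good operator
    have h := stepE_ge hn f p q (fun x op => pot k d G B (zs x) op) x op (ε ^ (2 * zs x - 1)) 0 ?_
      (fun v _ => hnn v)
    · refine le_trans ?_ h
      rw [ho, pot_good hS G B l1 l2 l3]
      have e : ε ^ (2 * zs x) = ε ^ (2 * zs x - 1) * ε := by
        rw [← pow_succ]; congr 1; omega
      have hpp : 0 < ε ^ (2 * zs x - 1) := by positivity
      have : 1 / (n : ℝ) * ε ^ (2 * zs x - 1) ≤ (zs x : ℝ) / n * ε ^ (2 * zs x - 1) := by gcongr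
      have h3 : 2 * ε ≤ 1 / n := by
        rw [le_div_iff₀ (by linarith)]; linarith
      have h4 : ε ^ (2 * zs x - 1) * (2 * ε) ≤ ε ^ (2 * zs x - 1) * (1 / n) := by gcongr
      simp only [hG, sub_zero, zero_add]
      linarith
    · intro v hv
      have hm := (moved_down hS l1 hv l2 l3).1
      rw [← ho] at hm
      simp only [hm]
      have hz := zs_flip_false x v hv
      have hlow : ∀ o, ε ^ (2 * zs x - 1) ≤ pot k d G B (zs (flipBit x v)) o := by
        intro o
        unfold pot
        split_ifs
        · exact pow_le_one₀ hε0.le hε1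
        · exact pow_le_pow_of_le_one hε0.le hε1 (by omega)
        · exact pow_le_pow_of_le_one hε0.le hε1 (by omega)
      have g1 := mul_le_mul_of_nonneg_left (hlow op) (show 0 ≤ 1 - r by linarith)
      have g2 := mul_le_mul_of_nonneg_left (hlow op.other) (show 0 ≤ r by linarith)
      linarith
  · -- bad operator
    have h := stepE_ge hn f p q (fun x op => pot k d G B (zs x) op) x op (A * ε ^ (2 * zs x)) 0 ?_
      (fun v _ => hnn v)
    · refine le_trans ?_ h
      rw [ho, pot_bad hS G B l1 l2 l3]
      have hpp : 0 < ε ^ (2 * zs x) := by positivity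
      have : 1 / (n : ℝ) * (A * ε ^ (2 * zs x)) ≤ (zs x : ℝ) / n * (A * ε ^ (2 * zs x)) := by gcongr
      have e : 1 / (n : ℝ) * (A * ε ^ (2 * zs x)) = 2 * ε ^ (2 * zs x + 1) := by
        rw [← hεA]; field_simp; ring
      simp only [hB, sub_zero, zero_add]
      linarith
    · intro v hv
      have hm := (moved_down hS l1 hv l2 l3).2
      rw [← ho] at hm
      simp only [hm]
      have hv' : pot k d G B (zs x) op.other = ε ^ (2 * zs x) := by
        rw [ho, other_other, pot_good hS G B l1 l2 l3]
      rw [hv']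
      have g1 := mul_nonneg (show 0 ≤ 1 - r by linarith) (hP0 (zs x) op)
      have g2 : A * ε ^ (2 * zs x) ≤ r * ε ^ (2 * zs x) := by gcongr
      linarith

/-! ### The drift for large `n` -/

/-- The weight of the boundary `d l`. -/
noncomputable def wt (n k : ℕ) (d : ℕ → ℕ) (κ : ℝ) (l : ℕ) : ℝ :=
  ∏ i ∈ Finset.Ico l (k + 1), (κ * ((d i : ℝ) / n))

lemma wt_top (κ : ℝ) : wt n k d κ (k+1) = 1 := by simp [wt]

lemma wt_step (κ : ℝ) {l : ℕ} (hl : l ≤ k) :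
    wt n k d κ l = κ * ((d l : ℝ) / n) * wt n k d κ (l + 1) := by
  unfold wt
  rw [Finset.prod_eq_prod_Ico_succ_bot (by omega)]

lemma wt_nonneg (κ : ℝ) (hκ : 0 ≤ κ) (l : ℕ) : 0 ≤ wt n k d κ l :=
  Finset.prod_nonneg fun _ _ => by positivity

lemma d_le (hS : SeqOpt n k d f) {i : ℕ} (hi : i ≤ k + 1) : d i ≤ n := by
  have := d_anti hS (Nat.zero_le i) hi
  rwa [hS.1] at this

lemma factor_le (hS : SeqOpt n k d f) {i : ℕ} (hi : i ≤ k + 1) : (d i : ℝ) / n ≤ 1 :=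
  div_le_one_of_le₀ (by exact_mod_cast d_le hS hi) (Nat.cast_nonneg n)

lemma wt_le_one (hS : SeqOpt n k d f) (κ : ℝ) (hκ : 0 ≤ κ) (hκ1 : κ ≤ 1) (l : ℕ) :
    wt n k d κ l ≤ 1 := by
  refine Finset.prod_le_one (fun _ _ => by positivity) fun i hi => ?_
  have := factor_le hS (i := i) (by have := Finset.mem_Ico.1 hi; omega)
  exact mul_le_one₀ hκ1 (by positivity) this

lemma wt_zero_le (hS : SeqOpt n k d f) (κ : ℝ) (hκ : 0 ≤ κ) (hκ1 : κ ≤ 1) {l : ℕ}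
    (hl : l ≤ k + 1) : wt n k d κ 0 ≤ wt n k d κ l := by
  have h : wt n k d κ 0 = (∏ i ∈ Finset.Ico 0 l, (κ * ((d i : ℝ) / n))) * wt n k d κ l :=
    (Finset.prod_Ico_consecutive _ (Nat.zero_le l) hl).symm
  rw [h]
  refine mul_le_of_le_one_left (wt_nonneg κ hκ l) ?_
  refine Finset.prod_le_one (fun _ _ => by positivity) fun i hi => ?_
  have := factor_le hS (i := i) (by have := Finset.mem_Ico.1 hi; omega)
  exact mul_le_one₀ hκ1 (by positivity) this

/-- Progress function within a region. -/
noncomputable def phi (c : ℝ) (y : ℕ) : ℝ := Real.exp (-(c * ∑ i ∈ Finset.range y, 1 / ((i : ℝ) + 1)))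

lemma phi_pos (c : ℝ) (y : ℕ) : 0 < phi c y := Real.exp_pos _

lemma phi_le_one (c : ℝ) (hc : 0 ≤ c) (y : ℕ) : phi c y ≤ 1 := by
  unfold phi
  rw [Real.exp_le_one_iff, neg_nonpos]
  exact mul_nonneg hc (Finset.sum_nonneg fun i _ => by positivity)

lemma phi_step (c : ℝ) (y : ℕ) :
    phi c (y + 1) * (1 + c / ((y : ℝ) + 1)) ≤ phi c y := by
  have e : phi c y = phi c (y + 1) * Real.exp (c / ((y : ℝ) + 1)) := by
    unfold phi
    rw [← Real.exp_add, Finset.sum_range_succ]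
    congr 1
    ring
  rw [e]
  have := Real.add_one_le_exp (c / ((y : ℝ) + 1))
  exact mul_le_mul_of_nonneg_left (by linarith) (phi_pos c (y + 1)).le

lemma phi_anti (c : ℝ) (hc : 0 ≤ c) {y z : ℕ} (h : y ≤ z) : phi c z ≤ phi c y := by
  unfold phi
  apply Real.exp_le_exp.2
  apply neg_le_neg
  apply mul_le_mul_of_nonneg_left _ hc
  exact Finset.sum_le_sum_of_subset_of_nonneg (Finset.range_mono h) fun i _ _ => by positivity

lemma phi_lower (b : ℝ) (hb : 0 ≤ b) (hlog : 1 ≤ Real.log n) {y : ℕ} (hy : y ≤ n) :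
    Real.exp (-(8 * b)) ≤ phi (4 * b / Real.log n) y := by
  refine le_trans ?_ (phi_anti _ (by positivity) hy)
  unfold phi
  apply Real.exp_le_exp.2
  apply neg_le_neg
  have h := harmonic_le_one_add_log n
  have e : ((harmonic n : ℚ) : ℝ) = ∑ i ∈ Finset.range n, 1 / ((i : ℝ) + 1) := by
    simp [harmonic]
  rw [e] at h
  calc 4 * b / Real.log n * ∑ i ∈ Finset.range n, 1 / ((i : ℝ) + 1)
      ≤ 4 * b / Real.log n * (2 * Real.log n) := by gcongr; linarith
    _ = 8 * b := by field_simp; ring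

open Classical in
/-- Value of good states. -/
noncomputable def bigG (n k : ℕ) (d : ℕ → ℕ) (κ c : ℝ) (y : ℕ) : ℝ :=
  if y = d (reg k d y) then
    1 / 4 * ((d (reg k d y) : ℝ) / n) * phi c y * wt n k d κ (reg k d y + 1)
  else phi c y * wt n k d κ (reg k d y + 1)

/-- Value of bad states. -/
noncomputable def bigB (n k : ℕ) (d : ℕ → ℕ) (κ : ℝ) (y : ℕ) : ℝ := wt n k d κ (reg k d y)

lemma reg_le (y : ℕ) : reg k d y ≤ k := Nat.findGreatest_le k

lemma bigG_nonneg (κ c : ℝ) (hκ : 0 ≤ κ) (y : ℕ) : 0 ≤ bigG n k d κ c y := by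
  have h1 := wt_nonneg (n := n) (k := k) (d := d) κ hκ (reg k d y + 1)
  have h2 := phi_pos c y
  unfold bigG
  split_ifs <;> positivity

lemma bigG_le_one (hS : SeqOpt n k d f) (κ c : ℝ) (hκ : 0 ≤ κ) (hκ1 : κ ≤ 1) (hc : 0 ≤ c)
    (y : ℕ) : bigG n k d κ c y ≤ 1 := by
  have h0 := wt_nonneg (n := n) (k := k) (d := d) κ hκ (reg k d y + 1)
  have h1 := wt_le_one hS κ hκ hκ1 (reg k d y + 1)
  have h2 := phi_pos c y
  have h3 := phi_le_one c hc y
  have h4 := factor_le hS (i := reg k d y) (by have := reg_le (k := k) (d := d) y; omega)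
  have h6 : phi c y * wt n k d κ (reg k d y + 1) ≤ 1 := mul_le_one₀ h3 h0 h1
  unfold bigG
  split_ifs
  · rw [mul_assoc]
    refine mul_le_one₀ ?_ (by positivity) h6
    linarith
  · exact h6

/-- Good values dominate bad values. -/
lemma bigG_ge (κ c : ℝ) (hκ : 0 ≤ κ) {y l : ℕ} (hl : l ≤ k)
    (hr : reg k d y = l) (hf : (d l : ℝ) / n ≤ 1) (hphi : 8 * κ ≤ phi c y) :
    2 * wt n k d κ l ≤ bigG n k d κ c y := by
  have h0 := wt_nonneg (n := n) (k := k) (d := d) κ hκ (l + 1)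
  have h2 := phi_pos c y
  have hd : 0 ≤ (d l : ℝ) / n := by positivity
  have h1 : 2 * wt n k d κ l ≤ 1 / 4 * ((d l : ℝ) / n) * phi c y * wt n k d κ (l + 1) := by
    rw [wt_step κ hl]
    have : 1 / 4 * ((d l : ℝ) / n) * (8 * κ) * wt n k d κ (l + 1)
      ≤ 1 / 4 * ((d l : ℝ) / n) * phi c y * wt n k d κ (l + 1) := by gcongr
    linarith
  unfold bigG
  rw [hr]
  split_ifs
  · exact h1
  · refine h1.trans ?_
    rw [mul_assoc]
    exact mul_le_of_le_one_left (by positivity) (by linarith)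

lemma drift_large (hn : 3 ≤ n) (hS : SeqOpt n k d f) (p q a b κ A P c : ℝ) (ha : 0 < a)
    (hab : a ≤ b) (hlog : 1 ≤ Real.log n) (hA : A = a / (n * Real.log n))
    (hP : P = b / (n * Real.log n)) (hP2 : P ≤ 1 / 2) (hc : c = 4 * b / Real.log n)
    (hAp : A ≤ p) (hAq : A ≤ q) (hPp : p ≤ P) (hPq : q ≤ P)
    (hκ : κ = Real.exp (-(8 * b)) / 8) (x : Point n) (op : Op)
    (hx : x ≠ optimum n) :
    pot k d (bigG n k d κ c) (bigB n k d κ) (zs x) op + A * wt n k d κ 0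
      ≤ stepE f p q
        (fun x op => pot k d (bigG n k d κ c) (bigB n k d κ) (zs x) op) x op := by
  have hn0 : 0 < n := by omega
  have hn' : (0 : ℝ) < n := by exact_mod_cast hn0
  have hb : 0 < b := ha.trans_le hab
  have hA0 : 0 < A := by rw [hA]; positivity
  have hAP : A ≤ P := by rw [hA, hP]; gcongr
  have hκ0 : 0 < κ := by rw [hκ]; positivity
  have hκ1 : κ ≤ 1 := by
    have : Real.exp (-(8 * b)) ≤ 1 := Real.exp_le_one_iff.2 (by linarith)
    rw [hκ]; linarith
  have hc0 : 0 < c := by rw [hc]; positivity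
  have hcP : c = 4 * P * n := by rw [hc, hP]; field_simp
  have hphi : ∀ {y : ℕ}, y ≤ n → 8 * κ ≤ phi c y := by
    intro y hy
    have := phi_lower b hb.le hlog hy
    rw [hκ, hc]; linarith
  obtain ⟨r1, r2⟩ := rate_bounds hAp hAq hPp hPq op
  set r := rate p q op with hr
  set G := bigG n k d κ c with hG
  set B := bigB n k d κ with hB
  have hG0 : ∀ y, 0 ≤ G y := bigG_nonneg κ c hκ0.le
  have hB0 : ∀ y, 0 ≤ B y := fun y => wt_nonneg κ hκ0.le _
  have hP0 := pot_nonneg (k := k) (d := d) G B hG0 hB0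
  have hy := zs_pos x hx
  have hyn := zs_le x
  obtain ⟨l1, l2, l3⟩ := reg_spec hS hy hyn
  set l := reg k d (zs x) with hl
  have hw0 := wt_zero_le hS κ hκ0.le hκ1 (show l ≤ k + 1 by omega)
  have hwl := wt_nonneg (n := n) (k := k) (d := d) κ hκ0.le l
  have hwl1 := wt_nonneg (n := n) (k := k) (d := d) κ hκ0.le (l + 1)
  have hfac := factor_le hS (i := l) (by omega)
  have hAw : A * wt n k d κ 0 ≤ A * wt n k d κ l := by gcongr
  have hnn : ∀ m, 0 ≤ (1 - r) * pot k d G B (zs (movedPoint f op x m)) op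
      + r * pot k d G B (zs (movedPoint f op x m)) op.other := fun m =>
    add_nonneg (mul_nonneg (by linarith) (hP0 _ _)) (mul_nonneg (by linarith) (hP0 _ _))
  rcases eq_or_other op (gop k l) with ho | ho
  · -- good operator
    have hGge := bigG_ge (n := n) (k := k) (d := d) κ c hκ0.le l1 hl.symm hfac (hphi hyn)
    obtain ⟨z, hz⟩ : ∃ z, zs x = z + 1 := ⟨zs x - 1, by omega⟩
    have hpo := phi_pos c z
    have hpo1 := phi_pos c (z + 1)
    have hpanti : phi c (z + 1) ≤ phi c z := phi_anti c hc0.le (Nat.le_succ z)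
    -- value after a downward move
    have hdown : ∀ v, x v = false → (1 - r) * (phi c z * wt n k d κ (l + 1)) ≤
        (1 - r) * pot k d G B (zs (movedPoint f op x v)) op
          + r * pot k d G B (zs (movedPoint f op x v)) op.other := by
      intro v hv
      have hm := (moved_down hS l1 hv l2 l3).1
      rw [← ho] at hm
      rw [hm]
      have hzf := zs_flip_false x v hv
      have hzz : zs (flipBit x v) = z := by omega
      rw [hzz]
      have hlow : phi c z * wt n k d κ (l + 1) ≤ pot k d G B z op := by
        rcases Nat.lt_or_ge (d (l + 1)) z with h | h
        · rw [ho, pot_good hS G B l1 h (by omega), hG]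
          unfold bigG
          rw [reg_eq hS l1 h (by omega), if_neg (by omega)]
        · have hzd : z = d (l + 1) := by omega
          have hle : phi c z * wt n k d κ (l + 1) ≤ wt n k d κ (l + 1) :=
            mul_le_of_le_one_left hwl1 (phi_le_one c hc0.le z)
          refine hle.trans ?_
          rcases Nat.eq_zero_or_pos z with h0 | h0
          · unfold pot
            rw [if_pos h0]
            exact wt_le_one hS κ hκ0.le hκ1 _
          · have hlk : l + 1 ≤ k := by
              by_contra hcon
              have : l = k := by omega
              rw [this, hS.2.1] at hzd
              omega
            have hdd := hS.2.2.1 (l + 1) hlk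
            have hop : op = (gop k (l + 1)).other := by
              rw [gop_succ k l hlk, other_other, ho]
            rw [hop, pot_bad hS G B hlk (by omega) (by omega), hB]
            unfold bigB
            rw [reg_eq hS hlk (by omega) (by omega)]
      have g1 := mul_le_mul_of_nonneg_left hlow (show 0 ≤ 1 - r by linarith)
      have g2 := mul_nonneg (show 0 ≤ r by linarith) (hP0 z op.other)
      linarith
    have hpg : pot k d G B (zs x) op = G (zs x) := by rw [ho, pot_good hS G B l1 l2 l3]
    rw [hpg]
    rcases eq_or_lt_of_le l3 with htop | hint
    · have h := stepE_ge hn0 f p q (fun x op => pot k d G B (zs x) op) x op _ 0 hdown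
        (fun v _ => hnn v)
      refine le_trans ?_ h
      have hGe : G (zs x)
          = 1 / 4 * ((d l : ℝ) / n) * phi c (zs x) * wt n k d κ (l + 1) := by
        rw [hG]; unfold bigG
        rw [← hl, if_pos htop]
      have hd0 : 0 ≤ (d l : ℝ) / n := by positivity
      have hA1 : A * wt n k d κ l ≤ 1 * wt n k d κ l := by gcongr; linarith
      have key : 2 * G (zs x) ≤ (zs x : ℝ) / n * ((1 - r) * (phi c z * wt n k d κ (l + 1)) - 0) := by
        rw [hGe, htop, sub_zero, ← htop, hz, ← hz, htop]
        have hh : phi c (d l) ≤ phi c z := by rw [← htop, hz]; exact hpanti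
        calc 2 * (1 / 4 * ((d l : ℝ) / n) * phi c (d l) * wt n k d κ (l + 1))
            = ((d l : ℝ) / n) * ((1 / 2) * (phi c (d l) * wt n k d κ (l + 1))) := by ring
          _ ≤ ((d l : ℝ) / n) * ((1 - r) * (phi c z * wt n k d κ (l + 1))) := by
              have hq1 := (phi_pos c (d l)).le
              have hq2 : (1 : ℝ) / 2 ≤ 1 - r := by linarith
              gcongr
      have hGge' : 2 * wt n k d κ l ≤ G (zs x) := hGge
      linarith
    · have hGe : G (zs x) = phi c (zs x) * wt n k d κ (l + 1) := by
        rw [hG]; unfold bigG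
        rw [← hl, if_neg (by omega)]
      have h := stepE_ge hn0 f p q (fun x op => pot k d G B (zs x) op) x op _
        ((1 - r) * (phi c (zs x) * wt n k d κ (l + 1))) hdown ?_
      · refine le_trans ?_ h
        set w := wt n k d κ (l + 1) with hw
        rw [← hG, hGe] at hGge
        rw [hGe]
        rw [hz] at hGge ⊢
        have hstep := phi_step c z
        have hy0 : (0 : ℝ) < (z : ℝ) + 1 := by positivity
        have hgain : 4 * P * phi c (z + 1) ≤ ((z : ℝ) + 1) / n * (phi c z - phi c (z + 1)) := by
          have h1 : phi c (z + 1) * (c / ((z : ℝ) + 1)) ≤ phi c z - phi c (z + 1) := by linarith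
          calc 4 * P * phi c (z + 1)
              = ((z : ℝ) + 1) / n * (phi c (z + 1) * (c / ((z : ℝ) + 1))) := by
                rw [hcP]; field_simp
            _ ≤ _ := by gcongr
        push_cast
        have e : (1 - r) * (phi c (z + 1) * w) + ((z : ℝ) + 1) / n *
            ((1 - r) * (phi c z * w) - (1 - r) * (phi c (z + 1) * w))
            = (1 - r) * (phi c (z + 1) + ((z : ℝ) + 1) / n * (phi c z - phi c (z + 1))) * w := by
          ring
        rw [e]
        have h5 : (1 - r) * (phi c (z + 1) + 4 * P * phi c (z + 1)) * w
            ≤ (1 - r) * (phi c (z + 1) + ((z : ℝ) + 1) / n * (phi c z - phi c (z + 1))) * w := by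
          have : 0 ≤ 1 - r := by linarith
          gcongr
        refine le_trans ?_ h5
        have hu : 0 ≤ phi c (z + 1) * w := by positivity
        have h6 : 1 + P ≤ (1 - r) * (1 + 4 * P) := by
          have hP0' : 0 < P := hA0.trans_le hAP
          nlinarith
        have h7 : (1 + P) * (phi c (z + 1) * w) ≤ (1 - r) * (1 + 4 * P) * (phi c (z + 1) * w) := by
          gcongr
        have h8 : A * wt n k d κ l ≤ P * (phi c (z + 1) * w) := by
          have : wt n k d κ l ≤ phi c (z + 1) * w := by linarith
          have hP0' : 0 < P := hA0.trans_le hAP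
          gcongr
        linarith
      · intro v hv
        have hm := (moved_up hS l1 hv l2.le hint).1
        rw [← ho] at hm
        simp only [hm]
        rw [hpg, hGe]
        have g2 := mul_nonneg (show 0 ≤ r by linarith) (hP0 (zs x) op.other)
        linarith
  · -- bad operator
    have hval : ∀ y, d (l + 1) < y → y ≤ d l →
        (1 + A) * wt n k d κ l ≤ (1 - r) * pot k d G B y op + r * pot k d G B y op.other := by
      intro y h1 h2
      have hreg := reg_eq hS l1 h1 h2
      have hyn' : y ≤ n := h2.trans (d_le hS (by omega))
      have hGge := bigG_ge (n := n) (k := k) (d := d) κ c hκ0.le l1 hreg hfac (hphi hyn')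
      have e1 : pot k d G B y op = wt n k d κ l := by
        rw [ho, pot_bad hS G B l1 h1 h2, hB]
        unfold bigB
        rw [hreg]
      have e2 : pot k d G B y op.other = G y := by
        rw [ho, other_other, pot_good hS G B l1 h1 h2]
      rw [e1, e2]
      have g1 := mul_le_mul_of_nonneg_left hGge (show 0 ≤ r by linarith)
      have g2 := mul_le_mul_of_nonneg_right r1 hwl
      linarith
    have h := stepE_ge hn0 f p q (fun x op => pot k d G B (zs x) op) x op
      ((1 + A) * wt n k d κ l) ((1 + A) * wt n k d κ l) ?_ ?_
    · refine le_trans ?_ h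
      have e1 : pot k d G B (zs x) op = wt n k d κ l := by
        rw [ho, pot_bad hS G B l1 l2 l3, hB]
        unfold bigB
        rw [← hl]
      rw [e1]
      linarith
    · intro v hv
      have hm := (moved_down hS l1 hv l2 l3).2
      rw [← ho] at hm
      simp only [hm]
      exact hval _ l2 l3
    · intro v hv
      rcases eq_or_lt_of_le l3 with htop | hint
      · have hm := moved_top hS l1 hv htop
        rw [← ho] at hm
        simp only [hm]
        exact hval _ l2 l3
      · have hm := (moved_up hS l1 hv l2.le hint).2
        rw [← ho] at hm
        have hz := zs_flip_true x v hv
        simp only [hm]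
        exact hval _ (by omega) (by omega)

end

lemma wt_zero_eq {n k : ℕ} {d : ℕ → ℕ} {f : Point n → ℝ} (hn : 0 < n) (hS : SeqOpt n k d f)
    (κ : ℝ) :
    wt n k d κ 0 = κ ^ (k + 1) * ((∏ i ∈ Finset.Icc 1 k, (d i : ℝ)) / (n : ℝ) ^ k) := by
  have hn' : (n : ℝ) ≠ 0 := by exact_mod_cast hn.ne'
  unfold wt
  rw [Finset.prod_mul_distrib, Finset.prod_eq_prod_Ico_succ_bot
    (f := fun i => (d i : ℝ) / n) (by omega), hS.1, div_self hn', one_mul,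
    Finset.prod_div_distrib]
  have : Finset.Ico (0 + 1) (k + 1) = Finset.Icc 1 k := by
    ext i; simp
  rw [this, Finset.prod_const, Finset.prod_const]
  simp only [Nat.card_Ico, Nat.card_Icc, Nat.sub_zero, Nat.add_sub_cancel]

/-- Runtime of the MMAHH with OI+OW on the `SEQOPT_k` benchmark class. -/
theorem mmahh_oi_ow_seqopt (k : ℕ) (a b : ℝ) (ha : 0 < a) (hab : a ≤ b) :
    ∃ C : ℝ, 0 < C ∧
      ∀ (n : ℕ), 3 ≤ n → k ≤ n - 2 →
        ∀ (d : ℕ → ℕ) (f : Point n → ℝ), SeqOpt n k d f →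
          ∀ (p q : ℝ), 0 < p → p < 1 → 0 < q → q < 1 →
            a / ((n : ℝ) * Real.log n) ≤ p → p ≤ b / ((n : ℝ) * Real.log n) →
            a / ((n : ℝ) * Real.log n) ≤ q → q ≤ b / ((n : ℝ) * Real.log n) →
            ∀ (Ω : Type) [MeasurableSpace Ω] (μ : Measure Ω) (X : ℕ → Ω → Point n × Op),
              IsProbabilityMeasure μ →
              IsMMAHH μ X f p q →
              (∀ x0 : Point n, μ {ω | X 0 ω = (x0, Op.OI)} = 1 / 2 ^ n) →
              ∫⁻ ω, (hitTime X ω : ℝ≥0∞) ∂μ ≤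
                ENNReal.ofReal (C * ((n : ℝ) ^ (k + 1) / ∏ i ∈ Finset.Icc 1 k, (d i : ℝ)) *
                  Real.log n) := by
  classical
  have hb : 0 < b := ha.trans_le hab
  set κ : ℝ := Real.exp (-(8 * b)) / 8 with hκ
  have hκ0 : 0 < κ := by positivity
  have hκ1 : κ ≤ 1 := by
    have : Real.exp (-(8 * b)) ≤ 1 := Real.exp_le_one_iff.2 (by linarith)
    rw [hκ]; linarith
  set N : ℕ := ⌈2 * b⌉₊ with hN
  set bs : ℕ → ℝ := fun m => 1 / (a / ((m : ℝ) * Real.log m) / (2 * m)) ^ (2 * m + 1) with hbs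
  have hbs0 : ∀ m, 0 ≤ bs m := by
    intro m
    have : 0 ≤ Real.log m := Real.log_natCast_nonneg m
    simp only [hbs]
    positivity
  have hsum0 : 0 ≤ ∑ m ∈ Finset.range N, bs m := Finset.sum_nonneg fun m _ => hbs0 m
  set C1 : ℝ := 1 / (a * κ ^ (k + 1)) with hC1
  have hC10 : 0 < C1 := by positivity
  refine ⟨C1 + ∑ m ∈ Finset.range N, bs m, by positivity, ?_⟩
  intro n hn hkn d f hS p q hp hp1 hq hq1 hAp hPp hAq hPq Ω _ μ X hμ hX _
  have hn0 : 0 < n := by omega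
  have hn3 : (3 : ℝ) ≤ n := by exact_mod_cast hn
  have hlog : 1 ≤ Real.log n := by
    rw [Real.le_log_iff_exp_le (by linarith)]
    have := Real.exp_one_lt_d9
    linarith
  have hA0 : 0 < a / ((n : ℝ) * Real.log n) := by positivity
  have hdpos : ∀ i ∈ Finset.Icc 1 k, 0 < d i := by
    intro i hi
    have hi' := Finset.mem_Icc.1 hi
    have := hS.2.2.1 i hi'.2
    omega
  have hprod0 : 0 < ∏ i ∈ Finset.Icc 1 k, (d i : ℝ) :=
    Finset.prod_pos fun i hi => by exact_mod_cast hdpos i hi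
  have hprodle : ∏ i ∈ Finset.Icc 1 k, (d i : ℝ) ≤ (n : ℝ) ^ k := by
    calc ∏ i ∈ Finset.Icc 1 k, (d i : ℝ) ≤ ∏ i ∈ Finset.Icc 1 k, (n : ℝ) := by
          refine Finset.prod_le_prod (fun _ _ => by positivity) fun i hi => ?_
          have hi' := Finset.mem_Icc.1 hi
          exact_mod_cast d_le hS (by omega)
      _ = (n : ℝ) ^ k := by simp
  have hratio : 1 ≤ (n : ℝ) ^ (k + 1) / ∏ i ∈ Finset.Icc 1 k, (d i : ℝ) := by
    rw [one_le_div hprod0]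
    refine hprodle.trans ?_
    exact pow_le_pow_right₀ (by linarith) (Nat.le_succ k)
  rcases Nat.lt_or_ge n N with hlt | hge
  · -- small `n`
    set A := a / ((n : ℝ) * Real.log n) with hA
    set ε := A / (2 * n) with hε
    have hε0 : 0 < ε := by positivity
    have hε1 : ε ≤ 1 := by
      rw [hε, div_le_one (by positivity)]
      linarith
    have h := runtime_of_drift hn0 μ X f p q hp hp1 hq hq1 hX
      (fun x op => pot k d (fun y => ε ^ (2 * y)) (fun y => ε ^ (2 * y + 1)) (zs x) op)
      (fun x op => pot_nonneg _ _ (fun y => by positivity) (fun y => by positivity) _ _)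
      (fun x op => pot_le_one _ _ (fun y => pow_le_one₀ hε0.le hε1)
        (fun y => pow_le_one₀ hε0.le hε1) _ _)
      (ε ^ (2 * n + 1)) (by positivity)
      (fun x op hx => drift_small hn0 hS p q A ε hA0 hAp hAq hp1.le hq1.le hε x op hx)
    refine h.trans (ENNReal.ofReal_le_ofReal ?_)
    have h1 : 1 / ε ^ (2 * n + 1) ≤ ∑ m ∈ Finset.range N, bs m :=
      Finset.single_le_sum (f := bs) (fun m _ => hbs0 m) (Finset.mem_range.2 hlt)
    have h2 : 1 / ε ^ (2 * n + 1) ≤ C1 + ∑ m ∈ Finset.range N, bs m := by linarith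
    refine h2.trans ?_
    rw [mul_assoc]
    exact le_mul_of_one_le_right (by positivity) (one_le_mul_of_one_le_of_one_le hratio hlog)
  · -- large `n`
    have hnb : 2 * b ≤ n := (Nat.le_ceil _).trans (by exact_mod_cast hge)
    have hP2 : b / ((n : ℝ) * Real.log n) ≤ 1 / 2 := by
      rw [div_le_iff₀ (by positivity)]
      nlinarith
    have hc0 : 0 ≤ 4 * b / Real.log n := by positivity
    have hw := wt_zero_eq hn0 hS κ
    have hw0 : 0 < wt n k d κ 0 := by rw [hw]; positivity
    have h := runtime_of_drift hn0 μ X f p q hp hp1 hq hq1 hX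
      (fun x op => pot k d (bigG n k d κ (4 * b / Real.log n)) (bigB n k d κ) (zs x) op)
      (fun x op => pot_nonneg _ _ (bigG_nonneg κ _ hκ0.le) (fun y => wt_nonneg κ hκ0.le _) _ _)
      (fun x op => pot_le_one _ _ (bigG_le_one hS κ _ hκ0.le hκ1 hc0)
        (fun y => wt_le_one hS κ hκ0.le hκ1 _) _ _)
      (a / ((n : ℝ) * Real.log n) * wt n k d κ 0) (mul_pos hA0 hw0)
      (fun x op hx => drift_large hn hS p q a b κ _ _ _ ha hab hlog rfl rfl hP2 rfl hAp hAq
        hPp hPq hκ x op hx)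
    refine h.trans (ENNReal.ofReal_le_ofReal ?_)
    have e : 1 / (a / ((n : ℝ) * Real.log n) * wt n k d κ 0)
        = C1 * ((n : ℝ) ^ (k + 1) / ∏ i ∈ Finset.Icc 1 k, (d i : ℝ)) * Real.log n := by
      rw [hw, hC1]
      field_simp
      ring
    rw [e]
    have hlog0 : 0 ≤ Real.log n := by linarith
    have hr0 : 0 ≤ (n : ℝ) ^ (k + 1) / ∏ i ∈ Finset.Icc 1 k, (d i : ℝ) := by linarith
    gcongr
    linarith
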